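/- arXiv:1602.07035 — 2 statements merged into one kernel-verified Lean document; each statement's English description precedes it below -/
import Mathlib

section
/- Every v-domain has the finite v-basic ideal property: if R is an integral domain in which every nonzero finitely generated ideal I satisfies (I·I⁻¹)_v = R, then every nonzero finitely generated ideal of R is v-basic. -/
open scoped nonZeroDivisors

theorem vb_nzd {R K : Type*} [CommRing R] [IsDomain R] [Field K] [Algebra R K]
    [IsFractionRing R K] : NoZeroDivisors (FractionalIdeal R⁰ K) := by
  refine ⟨fun {a b} h => ?_⟩
  by_contra! hc
  apply hc.1
  rw [FractionalIdeal.eq_zero_iff]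
  intro x hx
  by_contra hx0
  apply hc.2
  rw [FractionalIdeal.eq_zero_iff]
  intro y hy
  have := FractionalIdeal.mul_mem_mul hx hy
  rw [h, FractionalIdeal.mem_zero_iff] at this
  exact (mul_eq_zero.1 this).resolve_left hx0

theorem vb_le_inv {R K : Type*} [CommRing R] [IsDomain R] [Field K] [Algebra R K]
    [IsFractionRing R K] {X A : FractionalIdeal R⁰ K} (hA : A ≠ 0) :
    X ≤ A⁻¹ ↔ X * A ≤ 1 := by
  rw [FractionalIdeal.inv_eq, FractionalIdeal.le_div_iff_mul_le hA]

theorem vb_inv_ne {R K : Type*} [CommRing R] [IsDomain R] [Field K] [Algebra R K]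
    [IsFractionRing R K] {A B : FractionalIdeal R⁰ K} (hA : A ≠ 0) (hB : B ≠ 0)
    (h : A⁻¹⁻¹ = B⁻¹⁻¹) (hB' : B⁻¹ ≠ 0) : A⁻¹ ≤ B⁻¹ := by
  by_cases hA' : A⁻¹ = 0
  · rw [hA']; exact zero_le
  rw [vb_le_inv hB]
  have h1 : B ≤ B⁻¹⁻¹ := by
    rw [vb_le_inv hB', mul_comm, ← vb_le_inv hB]
  have h2 : A⁻¹⁻¹ * A⁻¹ ≤ 1 := (vb_le_inv hA').1 le_rfl
  rw [mul_comm]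
  exact (mul_le_mul_left (h1.trans h.ge) _).trans h2

theorem vb_cancel {R K : Type*} [CommRing R] [IsDomain R] [Field K] [Algebra R K]
    [IsFractionRing R K] {A B I : FractionalIdeal R⁰ K} (hA : A ≠ 0) (hB : B ≠ 0) (hI : I ≠ 0)
    (hI' : I * I⁻¹ ≠ 0) (hv : (I * I⁻¹)⁻¹ ≤ 1)
    (h : (A * I)⁻¹ ≤ (B * I)⁻¹) : A⁻¹ ≤ B⁻¹ := by
  haveI : NoZeroDivisors (FractionalIdeal R⁰ K) := vb_nzd
  rw [vb_le_inv hB]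
  refine le_trans ((vb_le_inv hI').2 ?_) hv
  have h1 : A⁻¹ * I⁻¹ ≤ (A * I)⁻¹ := by
    rw [vb_le_inv (mul_ne_zero hA hI)]
    have e1 : A⁻¹ * A ≤ 1 := (vb_le_inv hA).1 le_rfl
    have e2 : I⁻¹ * I ≤ 1 := (vb_le_inv hI).1 le_rfl
    calc A⁻¹ * I⁻¹ * (A * I) = (A⁻¹ * A) * (I⁻¹ * I) := by ring
      _ ≤ 1 * 1 := mul_le_mul' e1 e2
      _ = 1 := one_mul 1
  have h2 := (vb_le_inv (mul_ne_zero hB hI)).1 (h1.trans h)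
  calc A⁻¹ * B * (I * I⁻¹) = A⁻¹ * I⁻¹ * (B * I) := by ring
    _ ≤ 1 := h2

/-- Every `v`-domain has the finite `v`-basic ideal property: if every nonzero finitely
generated ideal `I` of `R` satisfies `(I·I⁻¹)_v = R`, then every nonzero finitely generated
ideal of `R` is `v`-basic. -/
theorem finite_v_basic_of_v_domain
    {R K : Type*} [CommRing R] [IsDomain R] [Field K] [Algebra R K] [IsFractionRing R K]
    (hv : ∀ I : Ideal R, I ≠ ⊥ → I.FG →
      (((I : FractionalIdeal R⁰ K) * (I : FractionalIdeal R⁰ K)⁻¹)⁻¹)⁻¹ = 1) :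
    ∀ I : Ideal R, I ≠ ⊥ → I.FG →
      ∀ J : Ideal R, J ≠ ⊥ → J ≤ I →
        (∃ n : ℕ, ((((J : FractionalIdeal R⁰ K) * (I : FractionalIdeal R⁰ K) ^ n)⁻¹)⁻¹)
            = ((((I : FractionalIdeal R⁰ K) ^ (n + 1))⁻¹)⁻¹)) →
        (((J : FractionalIdeal R⁰ K)⁻¹)⁻¹) = (((I : FractionalIdeal R⁰ K)⁻¹)⁻¹) := by
  intro I hI hfg J hJ hJI ⟨n, hn⟩
  haveI : NoZeroDivisors (FractionalIdeal R⁰ K) := vb_nzd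
  have hvI := hv I hI hfg
  have hI0 : (I : FractionalIdeal R⁰ K) ≠ 0 := FractionalIdeal.coeIdeal_ne_zero.2 hI
  have hJ0 : (J : FractionalIdeal R⁰ K) ≠ 0 := FractionalIdeal.coeIdeal_ne_zero.2 hJ
  have hJI' : (J : FractionalIdeal R⁰ K) ≤ I := FractionalIdeal.coeIdeal_le_coeIdeal K |>.2 hJI
  have hI1 : (I : FractionalIdeal R⁰ K) ≤ 1 := FractionalIdeal.coeIdeal_le_one
  generalize (I : FractionalIdeal R⁰ K) = A at *
  generalize (J : FractionalIdeal R⁰ K) = B at *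
  have inv0 : (0 : FractionalIdeal R⁰ K)⁻¹ = 0 := FractionalIdeal.inv_zero' K
  have hC' : (A * A⁻¹)⁻¹ ≠ 0 := by
    intro h; rw [h, inv0] at hvI; exact zero_ne_one hvI
  have hC : A * A⁻¹ ≠ 0 := by
    intro h; rw [h, inv0] at hC'; exact hC' rfl
  have hC1 : (A * A⁻¹)⁻¹ ≤ 1 := by
    have := (vb_le_inv hC').1 (le_refl _)
    rwa [hvI, one_mul] at this
  have key : ∀ m : ℕ, (B * A ^ m)⁻¹ ≤ (A * A ^ m)⁻¹ → B⁻¹ ≤ A⁻¹ := by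
    intro m
    induction m with
    | zero => intro h; simpa using h
    | succ m ih =>
      intro h
      apply ih
      refine vb_cancel (mul_ne_zero hJ0 (pow_ne_zero _ hI0)) (mul_ne_zero hI0 (pow_ne_zero _ hI0))
        hI0 hC hC1 ?_
      simpa only [pow_succ, mul_assoc] using h
  have h1 : B⁻¹ ≤ A⁻¹ := by
    apply key n
    rw [pow_succ'] at hn
    have hP := mul_ne_zero hI0 (pow_ne_zero n hI0)
    refine vb_inv_ne (mul_ne_zero hJ0 (pow_ne_zero _ hI0)) hP hn ?_
    have : (1 : FractionalIdeal R⁰ K) ≤ (A * A ^ n)⁻¹ := by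
      rw [vb_le_inv hP, one_mul, ← pow_succ']
      exact pow_le_one' hI1 _
    intro h
    rw [h] at this
    exact one_ne_zero (le_antisymm this (zero_le))
  have h2 : A⁻¹ ≤ B⁻¹ := by
    rw [vb_le_inv hJ0]
    exact (mul_le_mul_right hJI' _).trans ((vb_le_inv hI0).1 le_rfl)
  rw [le_antisymm h1 h2]
end

section
/- Let k be a field, T = k[x,y], M = (x,y)T, and R = k + M². Then M² is a nontrivial t-reduction of the fractional R-ideal M: (M²·M)_t = (M²)_t while (M²)_t = M² ≠ M = M_t; however, M² is not a (d-)reduction of M, i.e., M²·M^n ≠ M^{n+1} for every integer n ≥ 0. -/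
noncomputable section

variable (k : Type*) [Field k]

/-- `T = k[x,y]`, the polynomial ring in two indeterminates over `k`. -/
abbrev PolyT := MvPolynomial (Fin 2) k

/-- The maximal ideal `M = (x,y)T` of `T = k[x,y]`. -/
def idealM : Ideal (PolyT k) := Ideal.span {MvPolynomial.X 0, MvPolynomial.X 1}

/-- The subring `R = k + M²` of `T = k[x,y]`: the preimage under `T → T/M²` of the image
of `k`, i.e. the set of polynomials `f` with `f - c ∈ M²` for some `c ∈ k`. -/
def subR : Subalgebra k (PolyT k) :=
  Subalgebra.comap (Ideal.Quotient.mkₐ k (idealM k ^ 2)) ⊥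

/-- The common quotient field `K = k(x,y)` of `T` and `R`. -/
abbrev FieldK := FractionRing (PolyT k)

/-- `M` regarded as an `R`-submodule (fractional `R`-ideal) of `K = k(x,y)`. -/
def subM : Submodule (subR k) (FieldK k) :=
  Submodule.span (subR k) (algebraMap (PolyT k) (FieldK k) '' (idealM k : Set (PolyT k)))

/-- `T` regarded as an `R`-submodule (fractional `R`-ideal) of `K = k(x,y)`. -/
def subT : Submodule (subR k) (FieldK k) :=
  Submodule.span (subR k) (Set.range (algebraMap (PolyT k) (FieldK k)))

/-- The `t`-operation on fractional `R`-ideals (realized as `R`-submodules of `K`):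
`A_t = ⋃ B_v` over the nonzero finitely generated `R`-submodules `B` of `A`, where
`B_v = 1/(1/B)`. -/
def tSub (A : Submodule (subR k) (FieldK k)) : Submodule (subR k) (FieldK k) :=
  ⨆ (B : Submodule (subR k) (FieldK k)) (_ : B ≠ ⊥) (_ : B ≤ A) (_ : B.FG),
    (1 : Submodule (subR k) (FieldK k)) / ((1 : Submodule (subR k) (FieldK k)) / B)

/-- The image in `K` of an ideal of `T`, as an `R`-submodule. -/
def imgI (I : Ideal (PolyT k)) : Submodule (subR k) (FieldK k) :=
  Submodule.map (IsScalarTower.toAlgHom (subR k) (PolyT k) (FieldK k)).toLinearMap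
    (I.restrictScalars (subR k))

lemma mem_imgI (I : Ideal (PolyT k)) (u : FieldK k) :
    u ∈ imgI k I ↔ ∃ f ∈ I, algebraMap (PolyT k) (FieldK k) f = u := by
  simp [imgI]

lemma imgI_mul (I J : Ideal (PolyT k)) : imgI k (I * J) = imgI k I * imgI k J := by
  unfold imgI
  rw [← Submodule.map_mul, Submodule.restrictScalars_mul]

lemma subM_eq : subM k = imgI k (idealM k) := by
  apply le_antisymm
  · unfold subM
    rw [Submodule.span_le]
    rintro _ ⟨f, hf, rfl⟩
    exact (mem_imgI k _ _).2 ⟨f, hf, rfl⟩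
  · intro u hu
    obtain ⟨f, hf, rfl⟩ := (mem_imgI k _ _).1 hu
    exact Submodule.subset_span ⟨f, hf, rfl⟩

lemma subM_pow (n : ℕ) : subM k ^ (n + 1) = imgI k (idealM k ^ (n + 1)) := by
  induction n with
  | zero => simp [subM_eq]
  | succ n ih => rw [pow_succ (subM k), ih, pow_succ (idealM k) (n + 1), imgI_mul, subM_eq]

lemma imgI_inj {I J : Ideal (PolyT k)} (h : imgI k I = imgI k J) : I = J := by
  have key : ∀ {I J : Ideal (PolyT k)}, imgI k I = imgI k J → I ≤ J := by
    intro I J h f hf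
    have : algebraMap (PolyT k) (FieldK k) f ∈ imgI k J := by
      rw [← h]; exact (mem_imgI k _ _).2 ⟨f, hf, rfl⟩
    obtain ⟨g, hg, hgf⟩ := (mem_imgI k _ _).1 this
    rwa [← IsFractionRing.injective (PolyT k) (FieldK k) hgf]
  exact le_antisymm (key h) (key h.symm)

/-- Restriction to the line `y = 0`. -/
def toLine : PolyT k →ₐ[k] Polynomial k :=
  MvPolynomial.aeval (fun i : Fin 2 => if i = 0 then Polynomial.X else 0)

lemma toLine_X0 : toLine k (MvPolynomial.X 0) = Polynomial.X := by simp [toLine]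
lemma toLine_X1 : toLine k (MvPolynomial.X 1) = 0 := by simp [toLine]

lemma X0_mem : (MvPolynomial.X 0 : PolyT k) ∈ idealM k := Ideal.subset_span (by simp)
lemma X1_mem : (MvPolynomial.X 1 : PolyT k) ∈ idealM k := Ideal.subset_span (by simp)

lemma toLine_pow {n : ℕ} {f : PolyT k} (hf : f ∈ idealM k ^ n) :
    Polynomial.X ^ n ∣ toLine k f := by
  have h1 : idealM k ≤ Ideal.comap (toLine k) (Ideal.span {Polynomial.X}) := by
    unfold idealM
    rw [Ideal.span_le]
    rintro _ (rfl | rfl)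
    · simp [toLine_X0, Ideal.mem_span_singleton]
    · simp [toLine_X1]
  have h2 := (Ideal.pow_right_mono h1 n).trans (Ideal.le_comap_pow (toLine k) n) hf
  rwa [Ideal.mem_comap, Ideal.span_singleton_pow, Ideal.mem_span_singleton] at h2

lemma pow_ne (n : ℕ) : idealM k ^ (n + 1) ≠ idealM k ^ n := by
  intro h
  have h1 : (MvPolynomial.X 0 : PolyT k) ^ n ∈ idealM k ^ (n + 1) := by
    rw [h]; exact Ideal.pow_mem_pow (X0_mem k) n
  have h2 := toLine_pow k h1
  rw [map_pow, toLine_X0, Polynomial.X_pow_dvd_iff] at h2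
  simpa using h2 n (by omega)

lemma sub_C_mem (f : PolyT k) : f - MvPolynomial.C (MvPolynomial.constantCoeff f) ∈ idealM k := by
  induction f using MvPolynomial.induction_on with
  | C a => simp
  | add p q hp hq =>
    have := (idealM k).add_mem hp hq
    convert this using 1
    simp only [map_add]; ring
  | mul_X p i hp =>
    have : (MvPolynomial.X i : PolyT k) ∈ idealM k := by
      fin_cases i
      · exact X0_mem k
      · exact X1_mem k
    simpa using (idealM k).mul_mem_left p this

lemma mem_subR {f : PolyT k} :
    f ∈ subR k ↔ ∃ c : k, f - MvPolynomial.C c ∈ idealM k ^ 2 := by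
  unfold subR
  rw [Subalgebra.mem_comap, Algebra.mem_bot]
  constructor
  · rintro ⟨c, hc⟩
    refine ⟨c, ?_⟩
    rw [← Ideal.Quotient.eq]
    exact hc.symm
  · rintro ⟨c, hc⟩
    refine ⟨c, ?_⟩
    rw [← Ideal.Quotient.eq] at hc
    exact hc.symm

lemma toLine_C (c : k) : toLine k (MvPolynomial.C c) = Polynomial.C c := by
  simp [toLine]

lemma coeff_zero_of_mul {f : PolyT k} (h : f * MvPolynomial.X 0 ∈ subR k) :
    (toLine k f).coeff 0 = 0 := by
  obtain ⟨c, hc⟩ := (mem_subR k).1 h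
  have := toLine_pow k hc
  rw [Polynomial.X_pow_dvd_iff] at this
  have := this 1 (by norm_num)
  simpa [toLine_C, toLine_X0, Polynomial.coeff_C] using this

lemma mem_M_of_mul {f : PolyT k} (h : f * MvPolynomial.X 0 ∈ subR k) : f ∈ idealM k := by
  have h0 := coeff_zero_of_mul k h
  have h1 := sub_C_mem k f
  have h2 := toLine_pow (n := 1) k (by simpa using h1)
  rw [Polynomial.X_pow_dvd_iff] at h2
  have := h2 0 (by norm_num)
  rw [map_sub, Polynomial.coeff_sub, h0, toLine_C] at this
  have hz : MvPolynomial.constantCoeff f = 0 := by simpa using this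
  simpa [hz] using h1

lemma mem_M2_of_mul {f : PolyT k} (hf : f ∈ subR k) (h : f * MvPolynomial.X 0 ∈ subR k) :
    f ∈ idealM k ^ 2 := by
  have h0 := coeff_zero_of_mul k h
  obtain ⟨c, h1⟩ := (mem_subR k).1 hf
  have h2 := toLine_pow k h1
  rw [Polynomial.X_pow_dvd_iff] at h2
  have := h2 0 (by norm_num)
  rw [map_sub, Polynomial.coeff_sub, h0, toLine_C] at this
  have hz : c = 0 := by simpa using this
  simpa [hz] using h1

lemma M2_le_R {f : PolyT k} (hf : f ∈ idealM k ^ 2) : f ∈ subR k :=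
  (mem_subR k).2 ⟨0, by simpa using hf⟩

lemma mem_one_iff (u : FieldK k) : u ∈ (1 : Submodule (subR k) (FieldK k)) ↔
    ∃ f ∈ subR k, algebraMap (PolyT k) (FieldK k) f = u := by
  rw [Submodule.mem_one]
  constructor
  · rintro ⟨r, rfl⟩
    exact ⟨r, r.2, rfl⟩
  · rintro ⟨f, hf, rfl⟩
    exact ⟨⟨f, hf⟩, rfl⟩

lemma alg_mem_one {f : PolyT k} (h : algebraMap (PolyT k) (FieldK k) f ∈
    (1 : Submodule (subR k) (FieldK k))) : f ∈ subR k := by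
  obtain ⟨g, hg, he⟩ := (mem_one_iff k _).1 h
  rwa [← IsFractionRing.injective (PolyT k) (FieldK k) he]

lemma mem_T_of (n : ℕ) (u : FieldK k) 
    (h0 : u * algebraMap (PolyT k) (FieldK k) (MvPolynomial.X 0 ^ n) ∈
      (1 : Submodule (subR k) (FieldK k)))
    (h1 : u * algebraMap (PolyT k) (FieldK k) (MvPolynomial.X 1 ^ n) ∈
      (1 : Submodule (subR k) (FieldK k))) :
    ∃ f, algebraMap (PolyT k) (FieldK k) f = u := by
  obtain ⟨f, -, hf⟩ := (mem_one_iff k _).1 h0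
  obtain ⟨g, -, hg⟩ := (mem_one_iff k _).1 h1
  have e : f * MvPolynomial.X 1 ^ n = MvPolynomial.X 0 ^ n * g := by
    apply IsFractionRing.injective (PolyT k) (FieldK k)
    rw [map_mul, map_mul, hf, hg]; ring
  have hp : Prime (MvPolynomial.X 0 : PolyT k) := MvPolynomial.X_prime
  have hnd : ¬ (MvPolynomial.X 0 : PolyT k) ∣ MvPolynomial.X 1 ^ n := by
    intro h
    have := hp.dvd_of_dvd_pow h
    rw [MvPolynomial.X_dvd_X] at this
    exact absurd this (by decide)
  obtain ⟨q, rfl⟩ := hp.pow_dvd_of_dvd_mul_right n hnd ⟨g, e⟩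
  refine ⟨q, ?_⟩
  have hne : algebraMap (PolyT k) (FieldK k) (MvPolynomial.X 0 ^ n) ≠ 0 := by
    rw [Ne, IsFractionRing.to_map_eq_zero_iff]
    exact pow_ne_zero _ hp.ne_zero
  apply mul_right_cancel₀ hne
  rw [← hf, ← map_mul, mul_comm]

lemma div_anti {A B : Submodule (subR k) (FieldK k)} (h : A ≤ B) :
    (1 : Submodule (subR k) (FieldK k)) / B ≤ 1 / A := by
  intro u hu
  rw [Submodule.mem_div_iff_forall_mul_mem] at hu ⊢
  exact fun y hy => hu y (h hy)

lemma tSub_le_v (A : Submodule (subR k) (FieldK k)) : tSub k A ≤ 1 / (1 / A) := by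
  unfold tSub
  refine iSup_le fun B => iSup_le fun _ => iSup_le fun h => iSup_le fun _ => ?_
  exact div_anti k (div_anti k h)

lemma v_le_tSub {A B : Submodule (subR k) (FieldK k)} (h0 : B ≠ ⊥) (h : B ≤ A) (hfg : B.FG) :
    1 / (1 / B) ≤ tSub k A := by
  unfold tSub
  exact le_iSup_of_le B (le_iSup_of_le h0 (le_iSup_of_le h (le_iSup_of_le hfg le_rfl)))

lemma tSub_mono {A B : Submodule (subR k) (FieldK k)} (h : A ≤ B) : tSub k A ≤ tSub k B := by
  conv_lhs => unfold tSub
  exact iSup_le fun C => iSup_le fun h0 => iSup_le fun h1 => iSup_le fun h2 =>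
    v_le_tSub k h0 (h1.trans h) h2

lemma le_v (A : Submodule (subR k) (FieldK k)) : A ≤ 1 / (1 / A) := by
  intro u hu
  rw [Submodule.mem_div_iff_forall_mul_mem]
  intro y hy
  rw [Submodule.mem_div_iff_forall_mul_mem] at hy
  rw [mul_comm]
  exact hy u hu

lemma le_tSub (A : Submodule (subR k) (FieldK k)) : A ≤ tSub k A := by
  intro a ha
  by_cases h : a = 0
  · rw [h]; exact zero_mem _
  · refine v_le_tSub k (B := Submodule.span (subR k) {a}) ?_ ?_ ?_ (le_v k _ ?_)
    · simpa [Submodule.span_singleton_eq_bot] using h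
    · simpa [Submodule.span_le] using ha
    · exact Submodule.fg_span_singleton a
    · exact Submodule.mem_span_singleton_self a

lemma tSub_M : tSub k (subM k) = subM k := by
  refine le_antisymm ?_ (le_tSub k _)
  refine (tSub_le_v k _).trans ?_
  rw [subM_eq]
  have h1 : imgI k (idealM k) ≤ 1 / imgI k (idealM k) := by
    intro u hu
    rw [Submodule.mem_div_iff_forall_mul_mem]
    intro v hv
    obtain ⟨f, hf, rfl⟩ := (mem_imgI k _ _).1 hu
    obtain ⟨g, hg, rfl⟩ := (mem_imgI k _ _).1 hv
    rw [← map_mul, mem_one_iff]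
    refine ⟨_, M2_le_R k ?_, rfl⟩
    rw [pow_two]; exact Ideal.mul_mem_mul hf hg
  refine (div_anti k h1).trans ?_
  intro u hu
  rw [Submodule.mem_div_iff_forall_mul_mem] at hu
  have a0 := hu _ ((mem_imgI k _ _).2 ⟨_, X0_mem k, rfl⟩)
  have a1 := hu _ ((mem_imgI k _ _).2 ⟨_, X1_mem k, rfl⟩)
  obtain ⟨f, rfl⟩ := mem_T_of k 1 u (by simpa using a0) (by simpa using a1)
  rw [← map_mul] at a0
  exact (mem_imgI k _ _).2 ⟨f, mem_M_of_mul k (alg_mem_one k a0), rfl⟩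

lemma tSub_M2 : tSub k (subM k ^ 2) = subM k ^ 2 := by
  refine le_antisymm ?_ (le_tSub k _)
  refine (tSub_le_v k _).trans ?_
  rw [subM_pow k 1]
  have h1 : imgI k ⊤ ≤ 1 / imgI k (idealM k ^ 2) := by
    intro u hu
    rw [Submodule.mem_div_iff_forall_mul_mem]
    intro v hv
    obtain ⟨f, -, rfl⟩ := (mem_imgI k _ _).1 hu
    obtain ⟨g, hg, rfl⟩ := (mem_imgI k _ _).1 hv
    rw [← map_mul, mem_one_iff]
    exact ⟨_, M2_le_R k (Ideal.mul_mem_left _ _ hg), rfl⟩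
  refine (div_anti k h1).trans ?_
  intro u hu
  rw [Submodule.mem_div_iff_forall_mul_mem] at hu
  have a0 := hu _ ((mem_imgI k _ _).2 ⟨MvPolynomial.X 0, trivial, rfl⟩)
  have a1 := hu _ ((mem_imgI k _ _).2 ⟨1, trivial, rfl⟩)
  rw [map_one, mul_one] at a1
  obtain ⟨f, hf, rfl⟩ := (mem_one_iff k _).1 a1
  rw [← map_mul] at a0
  exact (mem_imgI k _ _).2 ⟨f, mem_M2_of_mul k hf (alg_mem_one k a0), rfl⟩

lemma M2_le_tSub_M3 : subM k ^ 2 ≤ tSub k (subM k ^ 3) := by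
  have hle : Submodule.span (subR k) {algebraMap (PolyT k) (FieldK k) (MvPolynomial.X 0 ^ 3),
      algebraMap (PolyT k) (FieldK k) (MvPolynomial.X 1 ^ 3)} ≤ subM k ^ 3 := by
    rw [Submodule.span_le, subM_pow k 2]
    rintro _ (rfl | rfl)
    · exact (mem_imgI k _ _).2 ⟨_, Ideal.pow_mem_pow (X0_mem k) 3, rfl⟩
    · exact (mem_imgI k _ _).2 ⟨_, Ideal.pow_mem_pow (X1_mem k) 3, rfl⟩
  refine le_trans ?_ (v_le_tSub k ?_ hle (Submodule.fg_span (Set.toFinite _)))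
  · intro u hu
    rw [subM_pow k 1] at hu
    obtain ⟨g, hg, rfl⟩ := (mem_imgI k _ _).1 hu
    rw [Submodule.mem_div_iff_forall_mul_mem]
    intro v hv
    rw [Submodule.mem_div_iff_forall_mul_mem] at hv
    obtain ⟨f, rfl⟩ := mem_T_of k 3 v (hv _ (Submodule.subset_span (by simp)))
      (hv _ (Submodule.subset_span (by simp)))
    rw [← map_mul, mem_one_iff]
    exact ⟨_, M2_le_R k (Ideal.mul_mem_right _ _ hg), rfl⟩
  · intro h
    rw [Submodule.span_eq_bot] at h
    have := h _ (Set.mem_insert _ _)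
    rw [IsFractionRing.to_map_eq_zero_iff] at this
    exact pow_ne_zero 3 (MvPolynomial.X_ne_zero 0) this

/-- Let `T = k[x,y]`, `M = (x,y)T` and `R = k + M²`.  Then `M²` is a nontrivial
`t`-reduction of the fractional `R`-ideal `M`: `(M²·M)_t = (M²)_t`, while
`(M²)_t = M² ≠ M = M_t`; however, `M²` is not a `d`-reduction of `M`:
`M²·Mⁿ ≠ M^(n+1)` for every `n ≥ 0`. -/
theorem Msq_nontrivial_t_reduction_not_d_reduction :
    tSub k (subM k ^ 2 * subM k) = tSub k (subM k ^ 2)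
      ∧ tSub k (subM k ^ 2) = subM k ^ 2
      ∧ tSub k (subM k) = subM k
      ∧ subM k ^ 2 ≠ subM k
      ∧ ∀ n : ℕ, subM k ^ 2 * subM k ^ n ≠ subM k ^ (n + 1) := by
  have hne : ∀ n : ℕ, subM k ^ (n + 2) ≠ subM k ^ (n + 1) := by
    intro n h
    rw [subM_pow k n, subM_pow k (n + 1)] at h
    exact pow_ne k (n + 1) (imgI_inj k h)
  have h32 : subM k ^ 3 ≤ subM k ^ 2 := by
    rw [subM_pow k 2, subM_pow k 1]
    intro u hu
    obtain ⟨f, hf, rfl⟩ := (mem_imgI k _ _).1 hu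
    exact (mem_imgI k _ _).2 ⟨f, Ideal.pow_le_pow_right (by norm_num) hf, rfl⟩
  refine ⟨?_, tSub_M2 k, tSub_M k, ?_, ?_⟩
  · rw [← pow_succ]
    refine le_antisymm (tSub_mono k h32) ?_
    rw [tSub_M2]
    exact M2_le_tSub_M3 k
  · simpa using hne 0
  · intro n
    rw [← pow_add, add_comm]
    exact hne n

end
end
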